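/- For every integer q ≥ 2, an SYK graph G satisfies δ(G) = 1 if and only if G is melonic. -/

import Mathlib

namespace SYK

/-- A pre-SYK graph: a finite nonempty vertex set `V`, darts `V × Fin q`
(`Fin q` standing for the strand labels `{1,…,q}`), a fixed-point-free
involutive fermionic pairing `ferm` of the darts, and a fixed-point-free
involutive disorder pairing `dis` of the vertices.  (Connectivity of the
fermionic multigraph is *not* required.) -/
structure PreGraph (q : ℕ) where
  V : Type
  [fintypeV : Fintype V]
  [decEqV : DecidableEq V]
  [nonemptyV : Nonempty V]
  ferm : Equiv.Perm (V × Fin q)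
  dis : Equiv.Perm V
  ferm_invol : ∀ d, ferm (ferm d) = d
  ferm_fpf : ∀ d, ferm d ≠ d
  dis_invol : ∀ v, dis (dis v) = v
  dis_fpf : ∀ v, dis v ≠ v

attribute [instance] PreGraph.fintypeV PreGraph.decEqV PreGraph.nonemptyV

variable {q : ℕ}

/-- The darts of a pre-SYK graph. -/
abbrev PreGraph.Dart (H : PreGraph q) : Type := H.V × Fin q

/-- Relabelling of darts induced by a map of vertices. -/
def dartMap {q : ℕ} {α β : Type} (ι : α → β) (d : α × Fin q) : β × Fin q :=
  (ι d.1, d.2)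

/-- The involution `π̂` on darts induced by the disorder pairing:
`π̂ (v, m) = (π v, m)`. -/
def PreGraph.dishat (H : PreGraph q) : Equiv.Perm H.Dart :=
  Equiv.prodCongr H.dis (Equiv.refl (Fin q))

/-- Adjacency of vertices in the fermionic multigraph `G₀`, where fermionic
lines having a dart in `S` are deleted. -/
def PreGraph.adj0Off (H : PreGraph q) (S : Set H.Dart) (v w : H.V) : Prop :=
  ∃ m m' : Fin q, (v, m) ∉ S ∧ H.ferm (v, m) = (w, m')

/-- Adjacency of vertices in the fermionic multigraph `G₀`. -/
def PreGraph.adj0 (H : PreGraph q) : H.V → H.V → Prop :=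
  H.adj0Off ∅

/-- Connectivity of the fermionic multigraph `G₀`. -/
def PreGraph.Conn0 (H : PreGraph q) : Prop :=
  ∀ v w : H.V, Relation.ReflTransGen H.adj0 v w

/-- Adjacency of vertices in the multigraph `G⁺` (one edge per fermionic line
and one edge per disorder line), where fermionic lines having a dart in `S`
are deleted. -/
def PreGraph.adjPlusOff (H : PreGraph q) (S : Set H.Dart) (v w : H.V) : Prop :=
  H.adj0Off S v w ∨ H.dis v = w

/-- The subgroup of dart permutations generated by the fermionic pairing `τ`
and the induced disorder involution `π̂`; faces are its orbits. -/
def PreGraph.faceGroup (H : PreGraph q) : Subgroup (Equiv.Perm H.Dart) :=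
  Subgroup.closure {H.ferm, H.dishat}

/-- Two darts lie in a common face. -/
def PreGraph.SameFace (H : PreGraph q) (d₁ d₂ : H.Dart) : Prop :=
  d₁ ∈ MulAction.orbit H.faceGroup d₂

/-- `F H`: the number of faces, i.e. of orbits of `⟨τ, π̂⟩` on the darts. -/
noncomputable def PreGraph.F (H : PreGraph q) : ℕ :=
  Nat.card (MulAction.orbitRel.Quotient H.faceGroup H.Dart)

/-- The number of vertices `|V(H)|`. -/
noncomputable def PreGraph.nV (H : PreGraph q) : ℕ :=
  Nat.card H.V

/-- `δ(H) = F(H) − (q−1)·|V(H)|/2` (the division is exact: `|V(H)|` is even). -/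
noncomputable def PreGraph.delta (H : PreGraph q) : ℤ :=
  (H.F : ℤ) - ((q : ℤ) - 1) * ((H.nV / 2 : ℕ) : ℤ)

/-- `e` is a fermionic line: the set of the two darts of a `τ`-orbit. -/
def PreGraph.IsLine (H : PreGraph q) (e : Set H.Dart) : Prop :=
  ∃ d : H.Dart, e = {d, H.ferm d}

/-- The fermionic lines `e₁` and `e₂` belong to a common face. -/
def PreGraph.LinesShareFace (H : PreGraph q) (e₁ e₂ : Set H.Dart) : Prop :=
  ∃ d₁ ∈ e₁, ∃ d₂ ∈ e₂, H.SameFace d₁ d₂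

/-- Deleting the fermionic lines with a dart in `S` disconnects `G₀`. -/
def PreGraph.Disconnects0 (H : PreGraph q) (S : Set H.Dart) : Prop :=
  ¬ ∀ v w : H.V, Relation.ReflTransGen (H.adj0Off S) v w

/-- Deleting the fermionic lines with a dart in `S` disconnects `G⁺`. -/
def PreGraph.DisconnectsPlus (H : PreGraph q) (S : Set H.Dart) : Prop :=
  ¬ ∀ v w : H.V, Relation.ReflTransGen (H.adjPlusOff S) v w

/-- `{e₁, e₂}` is a 2-cut of the multigraph `G⁺`. -/
def PreGraph.TwoCutPlus (H : PreGraph q) (e₁ e₂ : Set H.Dart) : Prop :=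
  H.DisconnectsPlus (e₁ ∪ e₂)

/-- `{e₁, e₂}` is a 2-cut of the fermionic multigraph `G₀`. -/
def PreGraph.TwoCut0 (H : PreGraph q) (e₁ e₂ : Set H.Dart) : Prop :=
  H.Disconnects0 (e₁ ∪ e₂)

/-- An SYK graph: a pre-SYK graph whose fermionic multigraph `G₀` is
connected. -/
structure Graph (q : ℕ) extends PreGraph q where
  conn : toPreGraph.Conn0

/-- `G` is (a relabelling of) the minimal graph `G_min`: two vertices `a, b`
with `π a = b` and `τ (a, m) = (b, m)` for all `m`. -/
def Graph.IsMin (G : Graph q) : Prop :=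
  ∃ a b : G.V, a ≠ b ∧ (∀ v : G.V, v = a ∨ v = b) ∧ G.dis a = b ∧
    ∀ m : Fin q, G.ferm (a, m) = (b, m)

/-- `G'` is obtained from `G` by a melonic move: two new vertices `x, y` with
`π x = y` are inserted on a fermionic line `{d, τ d}` of `G`; the strand
`⟨0, _⟩ : Fin q` plays the role of the label `1` of `{1,…,q}`. -/
def Graph.MelonicMove (G G' : Graph q) : Prop :=
  ∃ (x y : G'.V) (ι : G.V → G'.V) (d : G.V × Fin q),
    Function.Injective ι ∧ x ≠ y ∧
    (∀ v' : G'.V, (¬ ∃ v, ι v = v') ↔ (v' = x ∨ v' = y)) ∧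
    G'.dis x = y ∧
    (∀ v, G'.dis (ι v) = ι (G.dis v)) ∧
    G'.ferm (dartMap ι d) = (x, ⟨0, d.2.pos⟩) ∧
    G'.ferm (y, ⟨0, d.2.pos⟩) = dartMap ι (G.ferm d) ∧
    (∀ k : Fin q, k ≠ ⟨0, d.2.pos⟩ → G'.ferm (x, k) = (y, k)) ∧
    (∀ d' : G.V × Fin q, d' ≠ d → d' ≠ G.ferm d →
      G'.ferm (dartMap ι d') = dartMap ι (G.ferm d'))

/-- Isomorphism of SYK graphs: a bijection of darts commuting with the
fermionic pairings and the induced disorder involutions, and mapping the `q`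
darts of each vertex onto the `q` darts of a single vertex. -/
def Graph.Isomorphic (G G' : Graph q) : Prop :=
  ∃ φ : (G.V × Fin q) ≃ (G'.V × Fin q),
    (∀ d, φ (G.ferm d) = G'.ferm (φ d)) ∧
    (∀ d, φ (G.toPreGraph.dishat d) = G'.toPreGraph.dishat (φ d)) ∧
    ∀ v : G.V, ∃ v' : G'.V, ∀ m : Fin q, (φ (v, m)).1 = v'

/-- `G` is melonic: isomorphic to a graph obtained from the minimal graph
`G_min` by a finite sequence of melonic moves. -/
def Graph.IsMelonic (G : Graph q) : Prop :=
  ∃ G₀ Gn : Graph q, G₀.IsMin ∧ Relation.ReflTransGen Graph.MelonicMove G₀ Gn ∧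
    G.Isomorphic Gn


/-- The pre-SYK graph obtained from `H` by replacing the fermionic pairing,
keeping the vertex set and the disorder pairing. -/
def PreGraph.withFerm (H : PreGraph q) (f : Equiv.Perm (H.V × Fin q))
    (hi : ∀ d, f (f d) = d) (hf : ∀ d, f d ≠ d) : PreGraph q where
  V := H.V
  fintypeV := H.fintypeV
  decEqV := H.decEqV
  nonemptyV := H.nonemptyV
  ferm := f
  dis := H.dis
  ferm_invol := hi
  ferm_fpf := hf
  dis_invol := H.dis_invol
  dis_fpf := H.dis_fpf

/-- `G` is the gluing `G₁^{(e₁)} ⋆ G₂^{(e₂)}` where `e₁ = {d₁, τ₁ d₁}` and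
`e₂ = {d₂, τ₂ d₂}`: the vertex set is the disjoint union of those of `G₁` and
`G₂`, the disorder pairing is the union of the two disorder pairings, and the
fermionic pairing agrees with `τ₁`, `τ₂` outside `e₁ ∪ e₂` and pairs `d₁` with
`d₂`, and `τ₁ d₁` with `τ₂ d₂`. -/
def Graph.IsStarGluing (G₁ G₂ G : Graph q) (d₁ : G₁.V × Fin q)
    (d₂ : G₂.V × Fin q) : Prop :=
  ∃ (ι₁ : G₁.V → G.V) (ι₂ : G₂.V → G.V),
    Function.Injective ι₁ ∧ Function.Injective ι₂ ∧
    (∀ v₁ v₂, ι₁ v₁ ≠ ι₂ v₂) ∧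
    (∀ v : G.V, (∃ v₁, ι₁ v₁ = v) ∨ (∃ v₂, ι₂ v₂ = v)) ∧
    (∀ v, G.dis (ι₁ v) = ι₁ (G₁.dis v)) ∧
    (∀ v, G.dis (ι₂ v) = ι₂ (G₂.dis v)) ∧
    G.ferm (dartMap ι₁ d₁) = dartMap ι₂ d₂ ∧
    G.ferm (dartMap ι₁ (G₁.ferm d₁)) = dartMap ι₂ (G₂.ferm d₂) ∧
    (∀ d, d ≠ d₁ → d ≠ G₁.ferm d₁ →
      G.ferm (dartMap ι₁ d) = dartMap ι₁ (G₁.ferm d)) ∧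
    (∀ d, d ≠ d₂ → d ≠ G₂.ferm d₂ →
      G.ferm (dartMap ι₂ d) = dartMap ι₂ (G₂.ferm d))

/-- `G` is the gluing `G₁^{(e₁)} ⋆̄ G₂^{(e₂)}`: as in `IsStarGluing` but the
fermionic pairing pairs `d₁` with `τ₂ d₂`, and `τ₁ d₁` with `d₂`. -/
def Graph.IsBarGluing (G₁ G₂ G : Graph q) (d₁ : G₁.V × Fin q)
    (d₂ : G₂.V × Fin q) : Prop :=
  ∃ (ι₁ : G₁.V → G.V) (ι₂ : G₂.V → G.V),
    Function.Injective ι₁ ∧ Function.Injective ι₂ ∧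
    (∀ v₁ v₂, ι₁ v₁ ≠ ι₂ v₂) ∧
    (∀ v : G.V, (∃ v₁, ι₁ v₁ = v) ∨ (∃ v₂, ι₂ v₂ = v)) ∧
    (∀ v, G.dis (ι₁ v) = ι₁ (G₁.dis v)) ∧
    (∀ v, G.dis (ι₂ v) = ι₂ (G₂.dis v)) ∧
    G.ferm (dartMap ι₁ d₁) = dartMap ι₂ (G₂.ferm d₂) ∧
    G.ferm (dartMap ι₁ (G₁.ferm d₁)) = dartMap ι₂ d₂ ∧
    (∀ d, d ≠ d₁ → d ≠ G₁.ferm d₁ →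
      G.ferm (dartMap ι₁ d) = dartMap ι₁ (G₁.ferm d)) ∧
    (∀ d, d ≠ d₂ → d ≠ G₂.ferm d₂ →
      G.ferm (dartMap ι₂ d) = dartMap ι₂ (G₂.ferm d))

/-- `H''` is the contraction of the disorder line `{v, w}` of `H`: its vertex
set is `V(H) ∖ {v, w}` (embedded via `ι`), its disorder pairing is the
restriction of that of `H`, and its fermionic pairing pairs `τ (v, m)` with
`τ (w, m)` for each strand `m` and agrees with `τ` on all other darts. -/
def PreGraph.IsContraction (H H'' : PreGraph q) (v w : H.V) : Prop :=
  ∃ ι : H''.V → H.V,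
    Function.Injective ι ∧
    (∀ u : H.V, (∃ u'', ι u'' = u) ↔ (u ≠ v ∧ u ≠ w)) ∧
    (∀ u, ι (H''.dis u) = H.dis (ι u)) ∧
    (∀ m : Fin q, ∃ a b : H''.V × Fin q,
      dartMap ι a = H.ferm (v, m) ∧ dartMap ι b = H.ferm (w, m) ∧
      H''.ferm a = b) ∧
    (∀ d : H''.V × Fin q,
      (∀ m : Fin q, dartMap ι d ≠ H.ferm (v, m) ∧ dartMap ι d ≠ H.ferm (w, m)) →
      dartMap ι (H''.ferm d) = H.ferm (dartMap ι d))

/-- `HL` is the closure of the side `side ⊆ V(G)` of the graph `G` cut along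
the fermionic lines `e₁, e₂`: its vertex set is `{v | side v}` (embedded via
`ι`), its disorder pairing is the restriction of that of `G`, and its
fermionic pairing pairs the `side`-dart of `e₁` with the `side`-dart of `e₂`
and agrees with `τ` on all darts not in `e₁ ∪ e₂`. -/
def Graph.IsSideClose (G : Graph q) (side : G.V → Prop)
    (e₁ e₂ : Set (G.V × Fin q)) (HL : PreGraph q) : Prop :=
  ∃ ι : HL.V → G.V,
    Function.Injective ι ∧
    (∀ v : G.V, (∃ u, ι u = v) ↔ side v) ∧
    (∀ u, ι (HL.dis u) = G.dis (ι u)) ∧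
    (∃ a b : HL.V × Fin q, dartMap ι a ∈ e₁ ∧ dartMap ι b ∈ e₂ ∧
      HL.ferm a = b) ∧
    (∀ d : HL.V × Fin q, dartMap ι d ∉ e₁ ∪ e₂ →
      dartMap ι (HL.ferm d) = G.ferm (dartMap ι d))


section Faces

/-- The face containing a dart. -/
def PreGraph.face (H : PreGraph q) (d : H.Dart) :
    MulAction.orbitRel.Quotient H.faceGroup H.Dart :=
  Quotient.mk _ d

theorem PreGraph.face_ferm (H : PreGraph q) (d : H.Dart) :
    H.face (H.ferm d) = H.face d :=
  Quotient.sound (MulAction.orbitRel_apply.2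
    ⟨⟨H.ferm, Subgroup.subset_closure (by simp)⟩, rfl⟩)

theorem PreGraph.face_dishat (H : PreGraph q) (d : H.Dart) :
    H.face (H.dishat d) = H.face d :=
  Quotient.sound (MulAction.orbitRel_apply.2
    ⟨⟨H.dishat, Subgroup.subset_closure (by simp)⟩, rfl⟩)

theorem PreGraph.face_dis (H : PreGraph q) (v : H.V) (m : Fin q) :
    H.face (H.dis v, m) = H.face (v, m) :=
  H.face_dishat (v, m)

theorem PreGraph.invariant_of_mem_faceGroup (H : PreGraph q) {X : Type*} (f : H.Dart → X)
    (hferm : ∀ d, f (H.ferm d) = f d) (hdis : ∀ d, f (H.dishat d) = f d)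
    {g : Equiv.Perm H.Dart} (hg : g ∈ H.faceGroup) : ∀ d, f (g d) = f d := by
  induction hg using Subgroup.closure_induction with
  | mem g hg =>
    rcases hg with rfl | rfl
    · exact hferm
    · exact hdis
  | one => intro d; rfl
  | mul g h _ _ hg hh => intro d; rw [Equiv.Perm.mul_apply, hg, hh]
  | inv g _ hg =>
    intro d
    exact (hg (g⁻¹ d)).symm.trans (congrArg f (g.apply_symm_apply d))

/-- A function on darts that is invariant under both involutions descends to faces. -/
def PreGraph.liftFace (H : PreGraph q) {X : Type*} (f : H.Dart → X)
    (hferm : ∀ d, f (H.ferm d) = f d) (hdis : ∀ d, f (H.dishat d) = f d) :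
    MulAction.orbitRel.Quotient H.faceGroup H.Dart → X :=
  Quotient.lift f (by
    rintro a b hab
    obtain ⟨g, rfl⟩ := MulAction.orbitRel_apply.1 hab
    exact H.invariant_of_mem_faceGroup f hferm hdis g.2 b)

@[simp]
theorem PreGraph.liftFace_face (H : PreGraph q) {X : Type*} (f : H.Dart → X)
    (hferm : ∀ d, f (H.ferm d) = f d) (hdis : ∀ d, f (H.dishat d) = f d) (d : H.Dart) :
    H.liftFace f hferm hdis (H.face d) = f d :=
  rfl

theorem PreGraph.exists_face_eq (H : PreGraph q)
    (c : MulAction.orbitRel.Quotient H.faceGroup H.Dart) : ∃ d, H.face d = c :=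
  Quotient.exists_rep c

theorem PreGraph.dishat_dishat (H : PreGraph q) (d : H.Dart) : H.dishat (H.dishat d) = d :=
  Prod.ext (H.dis_invol d.1) rfl

theorem PreGraph.dishat_ne (H : PreGraph q) (d : H.Dart) : H.dishat d ≠ d :=
  fun h => H.dis_fpf d.1 (congrArg Prod.fst h)

end Faces

section Isomorphism

theorem Graph.Isomorphic.F_eq {G G' : Graph q} (h : G.Isomorphic G') :
    G.toPreGraph.F = G'.toPreGraph.F := by
  obtain ⟨φ, hferm, hdis, -⟩ := h
  refine Nat.card_congr
    { toFun := G.liftFace (fun d => G'.face (φ d)) (fun d => ?_) (fun d => ?_)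
      invFun := G'.liftFace (fun d => G.face (φ.symm d)) (fun d => ?_) (fun d => ?_)
      left_inv := fun c => ?_
      right_inv := fun c => ?_ }
  · rw [hferm, G'.face_ferm]
  · rw [hdis, G'.face_dishat]
  · obtain ⟨e, rfl⟩ := φ.surjective d
    rw [← hferm, φ.symm_apply_apply, φ.symm_apply_apply, G.face_ferm]
  · obtain ⟨e, rfl⟩ := φ.surjective d
    rw [← hdis, φ.symm_apply_apply, φ.symm_apply_apply, G.face_dishat]
  · obtain ⟨d, rfl⟩ := G.exists_face_eq c
    simp
  · obtain ⟨d, rfl⟩ := G'.exists_face_eq c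
    simp

theorem Graph.Isomorphic.delta_eq (hq : 0 < q) {G G' : Graph q} (h : G.Isomorphic G') :
    G.toPreGraph.delta = G'.toPreGraph.delta := by
  have hV : G.toPreGraph.nV = G'.toPreGraph.nV := by
    obtain ⟨φ, -⟩ := h
    have := Nat.card_congr φ
    simp only [Nat.card_prod, Nat.card_fin] at this
    exact Nat.eq_of_mul_eq_mul_right hq this
  rw [PreGraph.delta, PreGraph.delta, h.F_eq, hV]

/-- The dart permutation relabelling the strands at each vertex. -/
def relabelDart {V : Type} (σ : V → Equiv.Perm (Fin q)) : Equiv.Perm (V × Fin q) :=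
  Equiv.prodShear (Equiv.refl V) σ

@[simp]
theorem relabelDart_apply {V : Type} (σ : V → Equiv.Perm (Fin q)) (d : V × Fin q) :
    relabelDart σ d = (d.1, σ d.1 d.2) :=
  rfl

@[simp]
theorem relabelDart_symm_apply {V : Type} (σ : V → Equiv.Perm (Fin q)) (d : V × Fin q) :
    (relabelDart σ).symm d = (d.1, (σ d.1).symm d.2) :=
  rfl

/-- The SYK graph obtained by relabelling the strands at each vertex. -/
def Graph.relabel (G : Graph q) (σ : G.V → Equiv.Perm (Fin q)) : Graph q where
  V := G.V
  ferm := ((relabelDart σ).symm.trans G.ferm).trans (relabelDart σ)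
  dis := G.dis
  ferm_invol d := by
    simp only [Equiv.trans_apply, Equiv.symm_apply_apply, G.ferm_invol, Equiv.apply_symm_apply]
  ferm_fpf d h := by
    rw [Equiv.trans_apply, ← Equiv.eq_symm_apply] at h
    exact G.ferm_fpf _ h
  dis_invol := G.dis_invol
  dis_fpf := G.dis_fpf
  conn v w := by
    refine Relation.ReflTransGen.mono ?_ v w (G.conn v w)
    rintro a b ⟨m, m', -, h⟩
    refine ⟨σ a m, σ b m', Set.notMem_empty _, ?_⟩
    simp [h]

theorem Graph.relabel_ferm (G : Graph q) (σ : G.V → Equiv.Perm (Fin q)) (d : G.V × Fin q) :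
    (G.relabel σ).ferm (relabelDart σ d) = relabelDart σ (G.ferm d) := by
  change relabelDart σ (G.ferm ((relabelDart σ).symm (relabelDart σ d))) = _
  rw [Equiv.symm_apply_apply]

theorem Graph.isomorphic_relabel (G : Graph q) (σ : G.V → Equiv.Perm (Fin q))
    (hσ : ∀ v, σ (G.dis v) = σ v) : G.Isomorphic (G.relabel σ) := by
  refine ⟨relabelDart σ, fun d => (G.relabel_ferm σ d).symm, fun d => ?_, fun v => ⟨v, fun m => rfl⟩⟩
  refine Prod.ext rfl ?_
  change σ (G.dis d.1) d.2 = σ d.1 d.2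
  rw [hσ]

end Isomorphism

section Delta

theorem Graph.IsMin.delta_eq_one {G : Graph q} (h : G.IsMin) : G.toPreGraph.delta = 1 := by
  obtain ⟨a, b, hab, hV, hdis, hferm⟩ := h
  have hferm' : ∀ m, G.ferm (b, m) = (a, m) := fun m => by rw [← hferm, G.ferm_invol]
  have hF : G.toPreGraph.F = q := by
    refine (Nat.card_congr ?_).trans (Nat.card_fin q)
    refine
      { toFun := G.liftFace Prod.snd ?_ (fun _ => rfl)
        invFun := fun m => G.face (a, m)
        left_inv := fun c => ?_
        right_inv := fun m => rfl }
    · rintro ⟨v, m⟩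
      rcases hV v with rfl | rfl
      · rw [hferm]
      · rw [hferm']
    · obtain ⟨⟨v, m⟩, rfl⟩ := G.exists_face_eq c
      rcases hV v with rfl | rfl
      · rfl
      · exact (G.face_ferm (a, m)).symm.trans (congrArg G.face (hferm m))
  have hn : G.toPreGraph.nV = 2 := by
    rw [PreGraph.nV, Nat.card_eq_two_iff]
    exact ⟨a, b, hab, Set.eq_univ_of_forall fun v => by simpa using hV v⟩
  rw [PreGraph.delta, hF, hn]
  simp

theorem Graph.MelonicMove.nV_eq {G G' : Graph q} (h : G.MelonicMove G') :
    G'.toPreGraph.nV = G.toPreGraph.nV + 2 := by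
  obtain ⟨x, y, ι, d, hι, hxy, hV, -⟩ := h
  have hr : (Set.range ι)ᶜ = {x, y} := by
    ext v
    exact hV v
  have h1 := Set.ncard_add_ncard_compl (Set.range ι)
  rw [hr, Set.ncard_pair hxy, Set.ncard_range_of_injective hι] at h1
  exact h1.symm

theorem Graph.MelonicMove.F_eq {G G' : Graph q} (h : G.MelonicMove G') :
    G'.toPreGraph.F = G.toPreGraph.F + (q - 1) := by
  classical
  obtain ⟨x, y, ι, d, hι, hxy, hV, hdx, hdι, hd, hy, hk, hf⟩ := h
  set z : Fin q := ⟨0, d.2.pos⟩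
  have hx' : ∀ v, ι v ≠ x := fun v hv => (hV x).2 (Or.inl rfl) ⟨v, hv⟩
  have hy' : ∀ v, ι v ≠ y := fun v hv => (hV y).2 (Or.inr rfl) ⟨v, hv⟩
  have hdy : G'.dis y = x := by rw [← hdx, G'.dis_invol]
  have hfx : G'.ferm (x, z) = dartMap ι d := by rw [← hd, G'.ferm_invol]
  have hfd : G'.ferm (dartMap ι (G.ferm d)) = (y, z) := by rw [← hy, G'.ferm_invol]
  have hk' : ∀ k, k ≠ z → G'.ferm (y, k) = (x, k) := fun k h => by rw [← hk k h, G'.ferm_invol]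
  have hcases : ∀ v', (∃ v, v' = ι v) ∨ v' = x ∨ v' = y := fun v' => by
    by_cases hv : ∃ v, ι v = v'
    · exact Or.inl (hv.imp fun _ h => h.symm)
    · exact Or.inr ((hV v').1 hv)
  let f : G'.Dart → MulAction.orbitRel.Quotient G.faceGroup G.Dart ⊕ {k : Fin q // k ≠ z} :=
    fun e => if he : ∃ v, ι v = e.1 then Sum.inl (G.face (he.choose, e.2))
      else if hm : e.2 = z then Sum.inl (G.face d) else Sum.inr ⟨e.2, hm⟩
  have fι : ∀ e : G.Dart, f (dartMap ι e) = Sum.inl (G.face e) := fun e => by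
    have he : ∃ v, ι v = ι e.1 := ⟨_, rfl⟩
    have : f (dartMap ι e) = Sum.inl (G.face (he.choose, e.2)) := dif_pos he
    rw [this, hι he.choose_spec]
  have fι' : ∀ v m, f (ι v, m) = Sum.inl (G.face (v, m)) := fun v m => fι (v, m)
  have fx : ∀ k, f (x, k) = if hm : k = z then Sum.inl (G.face d) else Sum.inr ⟨k, hm⟩ :=
    fun k => dif_neg ((hV x).2 (Or.inl rfl))
  have fy : ∀ k, f (y, k) = if hm : k = z then Sum.inl (G.face d) else Sum.inr ⟨k, hm⟩ :=
    fun k => dif_neg ((hV y).2 (Or.inr rfl))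
  have f_ferm : ∀ e, f (G'.ferm e) = f e := by
    rintro ⟨v', m⟩
    rcases hcases v' with ⟨v, rfl⟩ | rfl | rfl
    · change f (G'.ferm (dartMap ι (v, m))) = f (dartMap ι (v, m))
      by_cases h1 : (v, m) = d
      · rw [h1, hd, fι, fx, dif_pos rfl]
      · by_cases h2 : (v, m) = G.ferm d
        · rw [h2, hfd, fι, fy, dif_pos rfl, G.face_ferm]
        · rw [hf _ h1 h2, fι, fι, G.face_ferm]
    · by_cases hm : m = z
      · rw [hm, hfx, fι, fx, dif_pos rfl]
      · rw [hk m hm, fx, fy]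
    · by_cases hm : m = z
      · rw [hm, hy, fι, fy, dif_pos rfl, G.face_ferm]
      · rw [hk' m hm, fx, fy]
  have f_dis : ∀ e, f (G'.dishat e) = f e := by
    rintro ⟨v', m⟩
    change f (G'.dis v', m) = f (v', m)
    rcases hcases v' with ⟨v, rfl⟩ | rfl | rfl
    · rw [hdι, fι', fι', G.face_dis]
    · rw [hdx, fx, fy]
    · rw [hdy, fx, fy]
  have face_x : G'.face (x, z) = G'.face (dartMap ι d) := by rw [← hfx, G'.face_ferm]
  have face_y : ∀ k, G'.face (y, k) = G'.face (x, k) := fun k => by rw [← hdx, G'.face_dis]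
  have face_d : G'.face (dartMap ι (G.ferm d)) = G'.face (dartMap ι d) := by
    rw [← hy, G'.face_ferm, face_y, face_x]
  have hcard : Nat.card {k : Fin q // k ≠ z} = q - 1 := by simp
  rw [PreGraph.F, PreGraph.F, ← hcard, ← Nat.card_sum]
  refine Nat.card_congr
    { toFun := G'.liftFace f f_ferm f_dis
      invFun := Sum.elim (G.liftFace (fun e => G'.face (dartMap ι e)) (fun e => ?_) (fun e => ?_))
        (fun k => G'.face (x, k.1))
      left_inv := fun c => ?_
      right_inv := fun c => ?_ }
  · by_cases h1 : e = d
    · rw [h1, face_d]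
    · by_cases h2 : e = G.ferm d
      · rw [h2, G.ferm_invol, face_d]
      · rw [← hf _ h1 h2, G'.face_ferm]
  · change G'.face (ι (G.dis e.1), e.2) = G'.face (ι e.1, e.2)
    rw [← hdι, G'.face_dis]
  · obtain ⟨⟨v', m⟩, rfl⟩ := G'.exists_face_eq c
    rw [PreGraph.liftFace_face]
    rcases hcases v' with ⟨v, rfl⟩ | rfl | rfl
    · rw [fι']
      rfl
    · by_cases hm : m = z
      · rw [fx, dif_pos hm, hm, face_x]
        rfl
      · rw [fx, dif_neg hm]
        rfl
    · by_cases hm : m = z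
      · rw [fy, dif_pos hm, hm, face_y, face_x]
        rfl
      · rw [fy, dif_neg hm, face_y]
        rfl
  · rcases c with c | ⟨k, hkz⟩
    · obtain ⟨e, rfl⟩ := G.exists_face_eq c
      exact fι e
    · exact (fx k).trans (dif_neg hkz)

theorem Graph.MelonicMove.delta_eq {G G' : Graph q} (h : G.MelonicMove G') :
    G'.toPreGraph.delta = G.toPreGraph.delta := by
  have hq : 1 ≤ q := by
    obtain ⟨-, -, -, d, -⟩ := h
    exact d.2.pos
  rw [PreGraph.delta, PreGraph.delta, h.F_eq, h.nV_eq, Nat.add_div_right _ two_pos]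
  push_cast [hq]
  ring

theorem Graph.IsMelonic.delta_eq_one (hq : 0 < q) {G : Graph q} (h : G.IsMelonic) :
    G.toPreGraph.delta = 1 := by
  obtain ⟨G₀, Gn, hmin, hchain, hiso⟩ := h
  rw [hiso.delta_eq hq]
  clear hiso
  induction hchain with
  | refl => exact hmin.delta_eq_one
  | tail _ hmove ih => rw [hmove.delta_eq, ih]

end Delta

section Counting

theorem PreGraph.even_nV (H : PreGraph q) : Even H.nV := by
  have h : ∑ _v : H.V, (1 : ZMod 2) = 0 :=
    Finset.sum_involution (fun v _ => H.dis v) (fun _ _ => by decide)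
      (fun v _ _ => H.dis_fpf v) (fun _ _ => Finset.mem_univ _) (fun v _ => H.dis_invol v)
  rw [Finset.sum_const, nsmul_one, Finset.card_univ] at h
  rw [PreGraph.nV, Nat.card_eq_fintype_card]
  exact (ZMod.natCast_eq_zero_iff_even).1 h

/-- The number of faces of a pre-SYK graph is controlled by its darts, those lying in a face with
a single fermionic line being counted twice. -/
theorem PreGraph.four_mul_F_le (H : PreGraph q) :
    4 * H.F ≤ ∑ d : H.Dart, if H.ferm d = H.dishat d then 2 else 1 := by
  classical
  rw [PreGraph.F, Nat.card_eq_fintype_card, mul_comm, ← smul_eq_mul, ← Finset.card_univ,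
    ← Finset.sum_fiberwise Finset.univ H.face]
  refine Finset.card_nsmul_le_sum _ _ _ fun c _ => ?_
  obtain ⟨d, rfl⟩ := H.exists_face_eq c
  by_cases hd : H.ferm d = H.dishat d
  · have hd' : H.ferm (H.ferm d) = H.dishat (H.ferm d) := by
      rw [H.ferm_invol, hd, H.dishat_dishat]
    have hsub : ({d, H.ferm d} : Finset H.Dart) ⊆ Finset.univ.filter (H.face · = H.face d) := by
      intro e he
      simp only [Finset.mem_insert, Finset.mem_singleton] at he
      rcases he with rfl | rfl <;> simp [H.face_ferm]
    refine le_trans ?_ (Finset.sum_le_sum_of_subset hsub)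
    rw [Finset.sum_pair (H.ferm_fpf d).symm, if_pos hd, if_pos hd']
  · have h1 : H.dishat (H.ferm d) ≠ d := fun h => hd (by rw [← H.dishat_dishat (H.ferm d), h])
    have hsub : ({d, H.ferm d, H.dishat d, H.dishat (H.ferm d)} : Finset H.Dart) ⊆
        Finset.univ.filter (H.face · = H.face d) := by
      intro e he
      simp only [Finset.mem_insert, Finset.mem_singleton] at he
      rcases he with rfl | rfl | rfl | rfl <;> simp [H.face_ferm, H.face_dishat]
    have hcard : ({d, H.ferm d, H.dishat d, H.dishat (H.ferm d)} : Finset H.Dart).card = 4 := by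
      rw [Finset.card_insert_of_notMem, Finset.card_insert_of_notMem, Finset.card_pair]
      · exact fun h => H.ferm_fpf d (H.dishat.injective h).symm
      · simp only [Finset.mem_insert, Finset.mem_singleton, not_or]
        exact ⟨hd, (H.dishat_ne _).symm⟩
      · simp only [Finset.mem_insert, Finset.mem_singleton, not_or]
        exact ⟨(H.ferm_fpf d).symm, (H.dishat_ne d).symm, h1.symm⟩
    refine le_trans ?_ (Finset.sum_le_sum_of_subset hsub)
    rw [← hcard, Finset.card_eq_sum_ones]
    exact Finset.sum_le_sum fun e _ => by split_ifs <;> norm_num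

/-- A pre-SYK graph with `δ = 1` has a disorder line whose ends are joined by at least `q - 1`
fermionic lines preserving the strand. -/
theorem PreGraph.exists_strand_of_delta_eq_one (hq : 2 ≤ q) (H : PreGraph q)
    (h : H.delta = 1) :
    ∃ (v : H.V) (m : Fin q), ∀ k, k ≠ m → H.ferm (v, k) = (H.dis v, k) := by
  by_contra! hno
  have hv : ∀ v : H.V, (∑ k : Fin q, if H.ferm (v, k) = H.dishat (v, k) then 2 else 1) ≤
      2 * (q - 1) := by
    intro v
    obtain ⟨k₁, -, h₁⟩ := hno v ⟨0, by omega⟩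
    obtain ⟨k₂, h₂₁, h₂⟩ := hno v k₁
    have hbad : ({k₁, k₂} : Finset (Fin q)) ⊆
        Finset.univ.filter fun k => ¬ H.ferm (v, k) = H.dishat (v, k) := by
      intro e he
      simp only [Finset.mem_insert, Finset.mem_singleton] at he
      rcases he with rfl | rfl
      · exact Finset.mem_filter.2 ⟨Finset.mem_univ _, h₁⟩
      · exact Finset.mem_filter.2 ⟨Finset.mem_univ _, h₂⟩
    have h2 := Finset.card_le_card hbad
    rw [Finset.card_pair h₂₁.symm] at h2
    have h3 := Finset.card_filter_add_card_filter_not (s := Finset.univ)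
      (fun k : Fin q => H.ferm (v, k) = H.dishat (v, k))
    rw [Finset.card_univ, Fintype.card_fin] at h3
    rw [Finset.sum_ite, Finset.sum_const, Finset.sum_const, smul_eq_mul, smul_eq_mul]
    omega
  have hF := H.four_mul_F_le
  rw [Fintype.sum_prod_type] at hF
  have hle := hF.trans (Finset.sum_le_card_nsmul _ _ _ fun v _ => hv v)
  rw [Finset.card_univ, ← Nat.card_eq_fintype_card, smul_eq_mul] at hle
  change 4 * H.F ≤ H.nV * _ at hle
  obtain ⟨n, hn⟩ := H.even_nV
  rw [PreGraph.delta, hn, show (n + n) / 2 = n by omega] at h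
  rw [hn] at hle
  zify [show 1 ≤ q by omega] at hle
  nlinarith

end Counting

section Removal

theorem Graph.isMin_of_forall_strand (G : Graph q) (v : G.V)
    (h : ∀ k, G.ferm (v, k) = (G.dis v, k)) : G.IsMin := by
  refine ⟨v, G.dis v, (G.dis_fpf v).symm, fun u => ?_, rfl, h⟩
  induction G.conn v u with
  | refl => exact Or.inl rfl
  | tail _ hadj ih =>
    obtain ⟨m, m', -, hm⟩ := hadj
    rcases ih with rfl | rfl
    · rw [h] at hm
      exact Or.inr (congrArg Prod.fst hm).symm
    · rw [← h, G.ferm_invol] at hm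
      exact Or.inl (congrArg Prod.fst hm).symm

theorem Graph.ferm_fst_ne_of_strand (G : Graph q) {v w : G.V} {m : Fin q} (hvw : v ≠ w)
    (h : ∀ k, k ≠ m → G.ferm (v, k) = (w, k)) (hm : G.ferm (v, m) ≠ (w, m)) :
    (G.ferm (v, m)).1 ≠ v ∧ (G.ferm (v, m)).1 ≠ w := by
  have hinv := G.ferm_invol (v, m)
  obtain ⟨⟨u, k⟩, hu⟩ : ∃ e, e = G.ferm (v, m) := ⟨_, rfl⟩
  rw [← hu] at hinv ⊢
  constructor
  · rintro rfl
    by_cases hk : k = m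
    · exact G.ferm_fpf _ (hk ▸ hu).symm
    · rw [h k hk] at hinv
      exact hvw (congrArg Prod.fst hinv).symm
  · rintro rfl
    by_cases hk : k = m
    · exact hm (hk ▸ hu).symm
    · rw [← h k hk, G.ferm_invol] at hinv
      exact hk (congrArg Prod.snd hinv)

/-- Removing a melon: an SYK graph whose vertices `v` and `π v` are joined by all the
strand-preserving lines except the one of strand `m` comes, up to a relabelling of the strands,
from a melonic move on a smaller graph. -/
theorem Graph.exists_melonicMove_relabel (G : Graph q) (v : G.V) (m : Fin q)
    (h : ∀ k, k ≠ m → G.ferm (v, k) = (G.dis v, k)) (hm : G.ferm (v, m) ≠ (G.dis v, m)) :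
    ∃ H : Graph q, ∀ σ : H.V → Equiv.Perm (Fin q), (∀ u, σ (H.dis u) = σ u) →
      ∃ σ' : G.V → Equiv.Perm (Fin q), (∀ u, σ' (G.dis u) = σ' u) ∧
        (H.relabel σ).MelonicMove (G.relabel σ') := by
  classical
  obtain ⟨w, hw⟩ : ∃ w, G.dis v = w := ⟨_, rfl⟩
  rw [hw] at hm
  simp only [hw] at h
  have hwv : w ≠ v := hw ▸ G.dis_fpf v
  have hw' : G.dis w = v := by rw [← hw, G.dis_invol]
  have h' : ∀ k, k ≠ m → G.ferm (w, k) = (v, k) := fun k hk => by rw [← h k hk, G.ferm_invol]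
  have hm' : G.ferm (w, m) ≠ (v, m) := fun e => hm (by rw [← e, G.ferm_invol])
  obtain ⟨hav, haw⟩ := G.ferm_fst_ne_of_strand hwv.symm h hm
  obtain ⟨hbw, hbv⟩ := G.ferm_fst_ne_of_strand hwv h' hm'
  have hτa := G.ferm_invol (v, m)
  have hτb := G.ferm_invol (w, m)
  obtain ⟨a, ha⟩ : ∃ a, G.ferm (v, m) = a := ⟨_, rfl⟩
  obtain ⟨b, hb⟩ : ∃ b, G.ferm (w, m) = b := ⟨_, rfl⟩
  rw [ha] at hav haw hτa
  rw [hb] at hbv hbw hτb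
  have hab : a ≠ b := by
    rintro rfl
    exact hwv (congrArg Prod.fst (hτb.symm.trans hτa))
  have hout : ∀ d : G.V × Fin q, d.1 ≠ v ∧ d.1 ≠ w → d ≠ a → d ≠ b →
      (G.ferm d).1 ≠ v ∧ (G.ferm d).1 ≠ w := by
    rintro d ⟨hdv, hdw⟩ hda hdb
    have hinv := G.ferm_invol d
    obtain ⟨⟨u, k⟩, hu⟩ : ∃ e, G.ferm d = e := ⟨_, rfl⟩
    rw [hu] at hinv ⊢
    constructor
    · rintro rfl
      by_cases hk : k = m
      · exact hda (by rw [← hinv, ← ha, hk])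
      · rw [h k hk] at hinv
        exact hdw (congrArg Prod.fst hinv).symm
    · rintro rfl
      by_cases hk : k = m
      · exact hdb (by rw [← hinv, ← hb, hk])
      · rw [h' k hk] at hinv
        exact hdv (congrArg Prod.fst hinv).symm
  let g : G.V × Fin q → G.V × Fin q := fun d =>
    if d = a then b else if d = b then a else G.ferm d
  have ga : g a = b := if_pos rfl
  have gb : g b = a := by simp [g, hab.symm]
  have gd : ∀ d, d ≠ a → d ≠ b → g d = G.ferm d := fun d h1 h2 => by simp [g, h1, h2]
  have gout : ∀ d : G.V × Fin q, d.1 ≠ v ∧ d.1 ≠ w → (g d).1 ≠ v ∧ (g d).1 ≠ w := by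
    intro d hd
    by_cases h1 : d = a
    · rw [h1, ga]
      exact ⟨hbv, hbw⟩
    · by_cases h2 : d = b
      · rw [h2, gb]
        exact ⟨hav, haw⟩
      · rw [gd d h1 h2]
        exact hout d hd h1 h2
  have ginv : ∀ d : G.V × Fin q, d.1 ≠ v ∧ d.1 ≠ w → g (g d) = d := by
    intro d hd
    by_cases h1 : d = a
    · rw [h1, ga, gb]
    · by_cases h2 : d = b
      · rw [h2, gb, ga]
      · rw [gd d h1 h2, gd, G.ferm_invol]
        · intro e
          rw [← G.ferm_invol d, e, hτa] at hd
          exact hd.1 rfl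
        · intro e
          rw [← G.ferm_invol d, e, hτb] at hd
          exact hd.2 rfl
  have gne : ∀ d, g d ≠ d := by
    intro d
    by_cases h1 : d = a
    · rw [h1, ga]
      exact hab.symm
    · by_cases h2 : d = b
      · rw [h2, gb]
        exact hab
      · rw [gd d h1 h2]
        exact G.ferm_fpf d
  let U := {u : G.V // u ≠ v ∧ u ≠ w}
  have disout : ∀ u : U, G.dis u.1 ≠ v ∧ G.dis u.1 ≠ w := by
    rintro ⟨u, hu⟩
    refine ⟨fun e => hu.2 ?_, fun e => hu.1 ?_⟩
    · rw [← G.dis_invol u, e, hw]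
    · rw [← G.dis_invol u, e, hw']
  let fU : U × Fin q → U × Fin q := fun d =>
    (⟨(g (d.1.1, d.2)).1, gout (d.1.1, d.2) d.1.2⟩, (g (d.1.1, d.2)).2)
  have fU_coe : ∀ d, dartMap Subtype.val (fU d) = g (dartMap Subtype.val d) := fun d => rfl
  have coe_inj : Function.Injective (dartMap (q := q) (Subtype.val : U → G.V)) := by
    rintro ⟨⟨x, hx⟩, k⟩ ⟨⟨y, hy⟩, l⟩ e
    simp only [dartMap, Prod.mk.injEq] at e
    obtain ⟨rfl, rfl⟩ := e
    rfl
  have fU_invol : Function.Involutive fU := fun d => coe_inj (by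
    rw [fU_coe, fU_coe]
    exact ginv _ d.1.2)
  have dU_invol : Function.Involutive (fun u : U => (⟨G.dis u.1, disout u⟩ : U)) :=
    fun u => Subtype.ext (G.dis_invol u.1)
  let a' : U × Fin q := (⟨a.1, hav, haw⟩, a.2)
  have ha' : dartMap Subtype.val a' = a := rfl
  let H₀ : PreGraph q :=
    { V := U
      nonemptyV := ⟨a'.1⟩
      ferm := fU_invol.toPerm
      dis := dU_invol.toPerm
      ferm_invol := fU_invol
      ferm_fpf := fun d e => gne (dartMap Subtype.val d) (by
        rw [← fU_coe]
        exact congrArg _ e)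
      dis_invol := dU_invol
      dis_fpf := fun u e => G.dis_fpf u.1 (congrArg Subtype.val e) }
  have adj : ∀ d : U × Fin q, H₀.adj0 d.1 (fU d).1 := fun d =>
    ⟨d.2, (fU d).2, Set.notMem_empty _, rfl⟩
  let p : G.V → U := fun u => if hu : u ≠ v ∧ u ≠ w then ⟨u, hu⟩ else a'.1
  have pv : p v = a'.1 := dif_neg (by simp)
  have pw : p w = a'.1 := dif_neg (by simp)
  have pU : ∀ u : U, p u.1 = u := fun u => dif_pos u.2
  have fUa : (fU a').1 = p b.1 := by
    rw [← pU (fU a').1]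
    change p (g a).1 = _
    rw [ga]
  have hadj : ∀ d : G.V × Fin q, Relation.ReflTransGen H₀.adj0 (p d.1) (p (G.ferm d).1) := by
    rintro ⟨u, k⟩
    by_cases hk : k = m ∧ (u = v ∨ u = w)
    · obtain ⟨rfl, rfl | rfl⟩ := hk
      · rw [ha, pv, ← pU a'.1]
      · rw [hb, pw, ← fUa]
        exact .single (adj a')
    · by_cases hu : u ≠ v ∧ u ≠ w
      · by_cases h1 : (u, k) = a
        · rw [h1, hτa, pv, ← pU a'.1]
        · by_cases h2 : (u, k) = b
          · have hfb : fU (fU a') = a' := fU_invol a'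
            rw [h2, hτb, pw, ← fUa]
            have := adj (fU a')
            rw [hfb] at this
            exact .single this
          · have h3 : (fU (⟨u, hu⟩, k)).1 = p (G.ferm (u, k)).1 := by
              rw [← gd _ h1 h2]
              exact (pU (fU (⟨u, hu⟩, k)).1).symm
            have h4 : p u = ⟨u, hu⟩ := pU ⟨u, hu⟩
            rw [h4, ← h3]
            exact .single (adj (⟨u, hu⟩, k))
      · have huvw : u = v ∨ u = w := by tauto
        have hkm : k ≠ m := fun e => hk ⟨e, huvw⟩
        rcases huvw with rfl | rfl
        · rw [h k hkm, pv, pw]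
        · rw [h' k hkm, pv, pw]
  let H : Graph q :=
    { toPreGraph := H₀
      conn := fun x y => by
        have hp : ∀ u, Relation.ReflTransGen H₀.adj0 (p x.1) (p u) := fun u => by
          induction G.conn x.1 u with
          | refl => exact .refl
          | @tail s _ _ hstep ih =>
            obtain ⟨k, k', -, e⟩ := hstep
            have := hadj (s, k)
            rw [e] at this
            exact ih.trans this
        have := hp y.1
        rwa [pU, pU] at this }
  refine ⟨H, fun σ hσ => ?_⟩
  let z : Fin q := ⟨0, m.pos⟩
  let σ' : G.V → Equiv.Perm (Fin q) := fun u =>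
    if hu : u ≠ v ∧ u ≠ w then σ ⟨u, hu⟩ else Equiv.swap m z
  have σv : σ' v = Equiv.swap m z := dif_neg (by simp)
  have σw : σ' w = Equiv.swap m z := dif_neg (by simp)
  have σU : ∀ u : U, σ' u.1 = σ u := fun u => dif_pos u.2
  have hrel : ∀ d : U × Fin q,
      relabelDart σ' (dartMap Subtype.val d) = dartMap Subtype.val (relabelDart σ d) := fun d =>
    Prod.ext rfl (congrArg (fun s : Equiv.Perm (Fin q) => s d.2) (σU d.1))
  have hrelv : ∀ k, relabelDart σ' (v, Equiv.swap m z k) = (v, k) := fun k => by simp [σv]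
  have hrelw : ∀ k, relabelDart σ' (w, Equiv.swap m z k) = (w, k) := fun k => by simp [σw]
  have hferm : ∀ d e, G.ferm d = e →
      (G.relabel σ').ferm (relabelDart σ' d) = relabelDart σ' e := fun d e hde => by
    rw [← hde, G.relabel_ferm]
  have hswap : Equiv.swap m z z = m := Equiv.swap_apply_right m z
  refine ⟨σ', fun u => ?_, v, w, Subtype.val, relabelDart σ a', Subtype.val_injective, hwv.symm,
    fun u => ?_, hw, fun u => rfl, ?_, ?_, fun k hk => ?_, fun d hd₁ hd₂ => ?_⟩
  · by_cases hu : u ≠ v ∧ u ≠ w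
    · have h1 := σU ⟨u, hu⟩
      have h2 := σU (H.dis ⟨u, hu⟩)
      rw [hσ] at h2
      exact h2.trans h1.symm
    · have huvw : u = v ∨ u = w := by tauto
      rcases huvw with rfl | rfl
      · rw [hw, σv, σw]
      · rw [hw', σv, σw]
  · constructor
    · intro hu
      by_contra hne
      rw [not_or] at hne
      exact hu ⟨⟨u, hne⟩, rfl⟩
    · rintro hu ⟨⟨x, hx⟩, rfl⟩
      exact hu.elim hx.1 hx.2
  · have h1 : relabelDart σ' (v, m) = (v, z) := by rw [← hrelv z, hswap]
    exact (congrArg (G.relabel σ').ferm (hrel a').symm).trans ((hferm a _ hτa).trans h1)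
  · have h1 : relabelDart σ' (w, m) = (w, z) := by rw [← hrelw z, hswap]
    have h2 : relabelDart σ' b = dartMap Subtype.val (relabelDart σ (fU a')) := by
      rw [← hrel, fU_coe, ha', ga]
    exact (congrArg (G.relabel σ').ferm h1.symm).trans ((hferm _ _ hb).trans
      (h2.trans (congrArg (dartMap Subtype.val) (H.relabel_ferm σ a').symm)))
  · have hkm : Equiv.swap m z k ≠ m := by
      rwa [Ne, Equiv.swap_apply_eq_iff, Equiv.swap_apply_left]
    exact (congrArg (G.relabel σ').ferm (hrelv k).symm).trans
      ((hferm _ _ (h _ hkm)).trans (hrelw k))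
  · obtain ⟨e, rfl⟩ := (relabelDart σ).surjective d
    have h1 : e ≠ a' := fun h => hd₁ (congrArg _ h)
    have h2 : e ≠ fU a' := fun h =>
      hd₂ ((congrArg (relabelDart σ) h).trans (H.relabel_ferm σ a').symm)
    have h3 : G.ferm (dartMap Subtype.val e) = dartMap Subtype.val (fU e) := by
      rw [fU_coe, gd]
      · exact fun h => h1 (coe_inj h)
      · exact fun h => h2 (coe_inj (by rw [h, fU_coe, ha', ga]))
    exact (congrArg (G.relabel σ').ferm (hrel e).symm).trans ((hferm _ _ h3).trans
      ((hrel (fU e)).trans (congrArg (dartMap Subtype.val) (H.relabel_ferm σ e).symm)))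

/-- A graph with `δ = 1` is, after relabelling strands, obtained from the minimal graph by melonic
moves. -/
theorem Graph.exists_relabel_of_delta_eq_one (hq : 2 ≤ q) (G : Graph q)
    (hG : G.toPreGraph.delta = 1) :
    ∃ σ : G.V → Equiv.Perm (Fin q), (∀ v, σ (G.dis v) = σ v) ∧
      ∃ G₀ : Graph q, G₀.IsMin ∧ Relation.ReflTransGen Graph.MelonicMove G₀ (G.relabel σ) := by
  induction hn : G.toPreGraph.nV using Nat.strong_induction_on generalizing G with
  | _ n ih =>
    obtain ⟨v, m, hv⟩ := G.exists_strand_of_delta_eq_one hq hG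
    by_cases hm : G.ferm (v, m) = (G.dis v, m)
    · have hmin : G.IsMin := G.isMin_of_forall_strand v fun k => by
        by_cases hk : k = m
        · rw [hk, hm]
        · exact hv k hk
      obtain ⟨a, b, hab, hV, hdis, hferm⟩ := hmin
      exact ⟨fun _ => 1, fun _ => rfl, G.relabel fun _ => 1, ⟨a, b, hab, hV, hdis, hferm⟩, .refl⟩
    · obtain ⟨H, hH⟩ := G.exists_melonicMove_relabel v m hv hm
      obtain ⟨σ₁, hσ₁, hmove₁⟩ := hH (fun _ => 1) fun _ => rfl
      have hδ : H.toPreGraph.delta = 1 := by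
        rw [(H.isomorphic_relabel (fun _ => 1) fun _ => rfl).delta_eq (by omega),
          ← hmove₁.delta_eq, ← (G.isomorphic_relabel σ₁ hσ₁).delta_eq (by omega), hG]
      have hlt : H.toPreGraph.nV < n := by
        have : G.toPreGraph.nV = H.toPreGraph.nV + 2 := hmove₁.nV_eq
        omega
      obtain ⟨σ, hσ, G₀, hmin, hchain⟩ := ih _ hlt H hδ rfl
      obtain ⟨σ', hσ', hmove⟩ := hH σ hσ
      exact ⟨σ', hσ', G₀, hmin, hchain.tail hmove⟩

end Removal

/-- For every integer `q ≥ 2`, an SYK graph `G` satisfies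
`δ(G) = 1` if and only if `G` is melonic. -/
theorem syk_delta_eq_one_iff_melonic (q : ℕ) (hq : 2 ≤ q) (G : Graph q) :
    G.toPreGraph.delta = 1 ↔ G.IsMelonic := by
  refine ⟨fun h => ?_, fun h => h.delta_eq_one (by omega)⟩
  obtain ⟨σ, hσ, G₀, hmin, hchain⟩ := G.exists_relabel_of_delta_eq_one hq h
  exact ⟨G₀, G.relabel σ, hmin, hchain, G.isomorphic_relabel σ hσ⟩

end SYK
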